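/- Let X ⊂ ℙ^{17} be an 11-dimensional nondegenerate smooth complex projective quadratic variety of Fano index 8 which is covered by lines and such that, for a general point x ∈ X, the Hilbert scheme of lines L_x ⊂ ℙ((T_xX)^∨) = ℙ^{10} is projectively equivalent to a Gushel–Mukai 6-fold. Then for a general point x ∈ X, the locus Locus(L_x) ⊂ 𝕋_xX ≅ ℙ^{11} swept out by the lines on X through x is projectively equivalent to the cone Cone(o', L_x) ⊂ ℙ^{11} over L_x with vertex a point o' ∈ ℙ^{11} \ ℙ((T_xX)^∨). -/

import Mathlib

/-!
Common framework for formalizing "Quadratic Varieties of Small Codimension"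
(K. Watanabe), following Ionescu–Russo.

We model a projective variety as a subset of the complex projective space
`PS m := ℙ ℂ (Fin m → ℂ)` (which is `ℙ^{m-1}`, with `m` homogeneous coordinates).
-/

noncomputable section

open scoped BigOperators

/-- Complex projective space `ℙ^{m-1}`, described by `m` homogeneous coordinates. -/
abbrev PS (m : ℕ) : Type := Projectivization ℂ (Fin m → ℂ)

namespace PaperQV

/-- A polynomial vanishes at a point of projective space, i.e. on the whole
corresponding line in affine space. -/
def PVanish {m : ℕ} (p : MvPolynomial (Fin m) ℂ) (x : PS m) : Prop :=
  ∀ v ∈ x.submodule, MvPolynomial.eval v p = 0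

/-- The common zero locus, in projective space, of a set of polynomials. -/
def ZeroLocus {m : ℕ} (P : Set (MvPolynomial (Fin m) ℂ)) : Set (PS m) :=
  {x | ∀ p ∈ P, PVanish p x}

/-- Zariski-closed subsets of projective space. -/
def ZClosed {m : ℕ} (S : Set (PS m)) : Prop :=
  ∃ P : Set (MvPolynomial (Fin m) ℂ), S = ZeroLocus P

/-- Zariski closure. -/
def ZClosure {m : ℕ} (S : Set (PS m)) : Set (PS m) :=
  ⋂₀ {C | ZClosed C ∧ S ⊆ C}

/-- Irreducibility with respect to the Zariski topology. -/
def ZIrreducible {m : ℕ} (S : Set (PS m)) : Prop :=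
  S.Nonempty ∧ ∀ C₁ C₂ : Set (PS m), ZClosed C₁ → ZClosed C₂ → S ⊆ C₁ ∪ C₂ →
    S ⊆ C₁ ∨ S ⊆ C₂

/-- `X` contains a strictly increasing chain of `n + 1` irreducible Zariski-closed
subsets, i.e. `dim X ≥ n`. -/
def DimGE {m : ℕ} (X : Set (PS m)) (n : ℕ) : Prop :=
  ∃ c : Fin (n + 1) → Set (PS m),
    StrictMono c ∧ ∀ i, ZClosed (c i) ∧ ZIrreducible (c i) ∧ c i ⊆ X

/-- `X` has dimension exactly `n`. -/
def HasDim {m : ℕ} (X : Set (PS m)) (n : ℕ) : Prop :=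
  DimGE X n ∧ ¬ DimGE X (n + 1)

/-- The differential of a polynomial `p` at the vector `v`, as a linear functional. -/
def polyDiff {m : ℕ} (p : MvPolynomial (Fin m) ℂ) (v : Fin m → ℂ) :
    (Fin m → ℂ) →ₗ[ℂ] ℂ :=
  ∑ j, MvPolynomial.eval v (MvPolynomial.pderiv j p) • LinearMap.proj j

/-- The Zariski tangent space at `x ∈ X` of the affine cone over `X`:
the intersection of the kernels of the differentials at `x.rep` of all
polynomials vanishing on `X`. -/
def tangentSubmodule {m : ℕ} (X : Set (PS m)) (x : PS m) :
    Submodule ℂ (Fin m → ℂ) :=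
  ⨅ (p : MvPolynomial (Fin m) ℂ) (_ : ∀ y ∈ X, PVanish p y),
    LinearMap.ker (polyDiff p x.rep)

/-- `X ⊆ ℙ^{m-1}` is a smooth projective variety of dimension `n`:
it is Zariski closed, irreducible, of dimension `n`, and at every point the
Zariski tangent space of its affine cone has dimension `n + 1`. -/
def SmoothVariety {m : ℕ} (X : Set (PS m)) (n : ℕ) : Prop :=
  ZClosed X ∧ ZIrreducible X ∧ HasDim X n ∧
    ∀ x ∈ X, Module.finrank ℂ (tangentSubmodule X x) = n + 1

/-- `X` is nondegenerate: it is contained in no hyperplane. -/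
def Nondegenerate {m : ℕ} (X : Set (PS m)) : Prop :=
  ∀ φ : (Fin m → ℂ) →ₗ[ℂ] ℂ, (∀ x ∈ X, ∀ v ∈ x.submodule, φ v = 0) → φ = 0

/-- The hypersurfaces `Q i = 0` cut out `X` scheme-theoretically: `X` is their
set-theoretic intersection, and at every point of `X` the `Q i` realize the full
Zariski tangent space (i.e. their differentials span the conormal space, so they
generate the ideal sheaf of the smooth variety `X`). -/
def SchemeCutOutBy {m k : ℕ} (X : Set (PS m)) (Q : Fin k → MvPolynomial (Fin m) ℂ) : Prop :=
  X = {x | ∀ i, PVanish (Q i) x} ∧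
    ∀ x ∈ X, ∀ p : MvPolynomial (Fin m) ℂ, (∀ y ∈ X, PVanish p y) →
      (⨅ i, LinearMap.ker (polyDiff (Q i) x.rep)) ≤ LinearMap.ker (polyDiff p x.rep)

/-- `X` is scheme-theoretically defined by `c` (linearly) independent quadratic equations. -/
def CutOutByQuadrics {m : ℕ} (X : Set (PS m)) (c : ℕ) : Prop :=
  ∃ Q : Fin c → MvPolynomial (Fin m) ℂ,
    (∀ i, (Q i).IsHomogeneous 2) ∧ LinearIndependent ℂ Q ∧ SchemeCutOutBy X Q

/-- A quadratic variety: scheme-theoretically an intersection of quadrics. -/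
def IsQuadratic {m : ℕ} (X : Set (PS m)) : Prop :=
  ∃ c : ℕ, CutOutByQuadrics X c

/-- `X ⊆ ℙ^{m-1}` of dimension `n` is a complete intersection: it is cut out
scheme-theoretically by exactly `codim X = (m - 1) - n` hypersurfaces. -/
def IsCompleteIntersection {m : ℕ} (X : Set (PS m)) (n : ℕ) : Prop :=
  ∃ F : Fin (m - 1 - n) → MvPolynomial (Fin m) ℂ, ∃ d : Fin (m - 1 - n) → ℕ,
    (∀ i, (F i).IsHomogeneous (d i)) ∧ (∀ i, 1 ≤ d i) ∧ SchemeCutOutBy X F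

/-- Lines in projective space: projectivizations of 2-dimensional subspaces. -/
def IsLine {m : ℕ} (L : Set (PS m)) : Prop :=
  ∃ W : Submodule ℂ (Fin m → ℂ), Module.finrank ℂ W = 2 ∧ L = {x | x.submodule ≤ W}

/-- `X` is covered by lines. -/
def CoveredByLines {m : ℕ} (X : Set (PS m)) : Prop :=
  ∀ x ∈ X, ∃ L : Set (PS m), IsLine L ∧ x ∈ L ∧ L ⊆ X

/-- `X` and `Y` are projectively equivalent (via a linear isomorphism of the
ambient homogeneous coordinate spaces). -/
def ProjEquiv {m₁ m₂ : ℕ} (X : Set (PS m₁)) (Y : Set (PS m₂)) : Prop :=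
  ∃ (f : (Fin m₁ → ℂ) →ₗ[ℂ] (Fin m₂ → ℂ)) (hf : Function.Injective f),
    Function.Surjective f ∧ Projectivization.map f hf '' X = Y

/-- `X ⊆ ℙ^{m₁-1}` is projectively equivalent to a hyperplane section of
`S ⊆ ℙ^{m₂-1}`: a linear embedding of the ambient space of `X` onto a hyperplane
carries `X` onto the corresponding hyperplane section of `S`. -/
def ProjEquivToHyperplaneSection {m₁ m₂ : ℕ} (X : Set (PS m₁)) (S : Set (PS m₂)) : Prop :=
  ∃ (f : (Fin m₁ → ℂ) →ₗ[ℂ] (Fin m₂ → ℂ)) (hf : Function.Injective f),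
    Module.finrank ℂ (LinearMap.range f) + 1 = m₂ ∧
    Projectivization.map f hf '' X = S ∩ {y | y.submodule ≤ LinearMap.range f}

/-! ### Explicit varieties: the Segre 3-fold, the Grassmannian `G(2,ℂ⁵)`,
the 10-dimensional spinor variety, cones, and Gushel–Mukai 6-folds. -/

/-- Index bookkeeping for the Segre embedding `ℙ¹ × ℙ² → ℙ⁵`. -/
def segreIdx : Fin 6 → Fin 2 × Fin 3 :=
  ![(0, 0), (0, 1), (0, 2), (1, 0), (1, 1), (1, 2)]

/-- The Segre coordinates of a pair of vectors. -/
def segreVec (a : Fin 2 → ℂ) (b : Fin 3 → ℂ) : Fin 6 → ℂ :=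
  fun k => a (segreIdx k).1 * b (segreIdx k).2

/-- The Segre 3-fold `ℙ¹ × ℙ² ⊆ ℙ⁵`. -/
def Segre12 : Set (PS 6) :=
  {x | ∃ (a : Fin 2 → ℂ) (b : Fin 3 → ℂ) (hv : segreVec a b ≠ 0),
    x = Projectivization.mk ℂ (segreVec a b) hv}

/-- The pairs `i < j` in `Fin 5`, indexing Plücker coordinates. -/
def pluckerPair : Fin 10 → Fin 5 × Fin 5 :=
  ![(0, 1), (0, 2), (0, 3), (0, 4), (1, 2), (1, 3), (1, 4), (2, 3), (2, 4), (3, 4)]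

/-- The Plücker coordinates of the 2-plane spanned by `a`, `b` in `ℂ⁵`. -/
def pluckerVec (a b : Fin 5 → ℂ) : Fin 10 → ℂ :=
  fun k => a (pluckerPair k).1 * b (pluckerPair k).2
    - a (pluckerPair k).2 * b (pluckerPair k).1

/-- The Grassmannian `G(2, ℂ⁵) ⊆ ℙ⁹` in its Plücker embedding. -/
def Grass25 : Set (PS 10) :=
  {x | ∃ (a b : Fin 5 → ℂ) (hv : pluckerVec a b ≠ 0),
    x = Projectivization.mk ℂ (pluckerVec a b) hv}

/-- `pfc i` lists the four elements of `Fin 5 \ {i}`, in increasing order. -/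
def pfc : Fin 5 → Fin 4 → Fin 5 :=
  ![![1, 2, 3, 4], ![0, 2, 3, 4], ![0, 1, 3, 4], ![0, 1, 2, 4], ![0, 1, 2, 3]]

/-- The sub-Pfaffian of a (skew-symmetric) `5 × 5` matrix obtained by deleting
the `i`-th row and column. -/
def subPfaffian (A : Fin 5 → Fin 5 → ℂ) (i : Fin 5) : ℂ :=
  A (pfc i 0) (pfc i 1) * A (pfc i 2) (pfc i 3)
    - A (pfc i 0) (pfc i 2) * A (pfc i 1) (pfc i 3)
    + A (pfc i 0) (pfc i 3) * A (pfc i 1) (pfc i 2)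

/-- The spinor coordinates `(1, (a_{ij})_{i<j}, (Pf_i(A))_i)` of a skew-symmetric
`5 × 5` matrix: the affine parametrization of the spinor embedding. -/
def spinorTail (A : Fin 5 → Fin 5 → ℂ) : Fin 15 → ℂ :=
  (Fin.append (fun t : Fin 10 => A (pluckerPair t).1 (pluckerPair t).2)
    (subPfaffian A) : Fin (10 + 5) → ℂ)

def spinorVec (A : Fin 5 → Fin 5 → ℂ) : Fin 16 → ℂ :=
  fun k =>
    (Fin.cons (1 : ℂ) (spinorTail A) : Fin (15 + 1) → ℂ)
      (Fin.cast (show (16 : ℕ) = 15 + 1 by norm_num) k)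

/-- The 10-dimensional spinor variety `S^{10} ⊆ ℙ^{15}`: the Zariski closure of
the image of the space of skew-symmetric `5 × 5` matrices under the
sub-Pfaffian (spinor) parametrization. -/
def Spinor10 : Set (PS 16) :=
  ZClosure {x | ∃ A : Fin 5 → Fin 5 → ℂ, (∀ i j, A j i = - A i j) ∧
    ∃ hv : spinorVec A ≠ 0, x = Projectivization.mk ℂ (spinorVec A) hv}

/-- The cone with vertex `o` over a subset `Y` of projective space. -/
def ConeOver {m : ℕ} (o : PS m) (Y : Set (PS m)) : Set (PS m) :=
  {z | z = o ∨ ∃ y ∈ Y, z.submodule ≤ o.submodule ⊔ y.submodule}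

/-- Gushel–Mukai 6-folds `Σ^6_{10} ⊆ ℙ^{10}`: smooth 6-dimensional sections of
the cone over the Plücker-embedded `G(2,ℂ⁵) ⊆ ℙ⁹ ⊆ ℙ^{10}` by a smooth quadric
hypersurface. -/
def IsGushelMukai6 (W : Set (PS 11)) : Prop :=
  ∃ (f : (Fin 10 → ℂ) →ₗ[ℂ] (Fin 11 → ℂ)) (hf : Function.Injective f)
    (o : PS 11) (q : MvPolynomial (Fin 11) ℂ),
    ¬ o.submodule ≤ LinearMap.range f ∧
    q.IsHomogeneous 2 ∧
    (∀ v : Fin 11 → ℂ, MvPolynomial.eval v q = 0 →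
      (∀ j, MvPolynomial.eval v (MvPolynomial.pderiv j q) = 0) → v = 0) ∧
    W = ConeOver o (Projectivization.map f hf '' Grass25) ∩ {x | PVanish q x} ∧
    SmoothVariety W 6

/-! ### Lines through a point, the Hilbert scheme of lines `L_x`, general points. -/

/-- The line through `x` with direction vector `v` (the projectivization of the
span of `x` and `v`). -/
def LineThrough {m : ℕ} (x : PS m) (v : Fin m → ℂ) : Set (PS m) :=
  {y | y.submodule ≤ x.submodule ⊔ Submodule.span ℂ {v}}

/-- `W ⊆ ℙ^{n-1} = ℙ(T_x X)` is a model, via the tangent map, of the Hilbert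
scheme `L_x` of lines on `X` through `x`:  a linear identification `j` of `ℂⁿ`
with a complement of the line `x̂` inside the (affine cone) tangent space of `X`
at `x` carries `W` onto the set of tangent directions of lines on `X` through `x`. -/
def IsVMRTModel {m n : ℕ} (X : Set (PS m)) (x : PS m) (W : Set (PS n)) : Prop :=
  ∃ j : (Fin n → ℂ) →ₗ[ℂ] (Fin m → ℂ), Function.Injective j ∧
    LinearMap.range j ⊓ x.submodule = ⊥ ∧
    LinearMap.range j ⊔ x.submodule = tangentSubmodule X x ∧
    W = {u : PS n | LineThrough x (j u.rep) ⊆ X}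

/-- `P` holds at all points of `X` off some proper Zariski-closed subset,
i.e. at a general point of `X`. -/
def GenericallyOn {m : ℕ} (X : Set (PS m)) (P : PS m → Prop) : Prop :=
  ∃ C : Set (PS m), ZClosed C ∧ ¬ X ⊆ C ∧ ∀ x ∈ X \ C, P x

/-- The locus swept out by the lines on `X` through `x`. -/
def LocusOfLines {m : ℕ} (X : Set (PS m)) (x : PS m) : Set (PS m) :=
  ⋃₀ {L | IsLine L ∧ x ∈ L ∧ L ⊆ X}

/-! ### Products, morphisms, double covers, conics. -/

/-- Zariski-closed subsets of a product of projective spaces (cut out by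
multihomogeneous polynomials in the two groups of variables). -/
def ZClosedProd {m₁ m₂ : ℕ} (S : Set (PS m₁ × PS m₂)) : Prop :=
  ∃ P : Set (MvPolynomial (Fin m₁ ⊕ Fin m₂) ℂ),
    S = {z | ∀ p ∈ P, ∀ v ∈ z.1.submodule, ∀ w ∈ z.2.submodule,
      MvPolynomial.eval (Sum.elim v w) p = 0}

/-- `f` restricts to a morphism of projective varieties `X → Y`
(its graph over `X` is Zariski closed). -/
def IsMorphismOn {m₁ m₂ : ℕ} (X : Set (PS m₁)) (Y : Set (PS m₂))
    (f : PS m₁ → PS m₂) : Prop :=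
  Set.MapsTo f X Y ∧ ZClosedProd {z : PS m₁ × PS m₂ | z.1 ∈ X ∧ z.2 = f z.1}

/-- A double cover `X → Y`: a finite surjective morphism of degree `2`. -/
def IsDoubleCover {m₁ m₂ : ℕ} (X : Set (PS m₁)) (Y : Set (PS m₂))
    (f : PS m₁ → PS m₂) : Prop :=
  IsMorphismOn X Y f ∧ Set.SurjOn f X Y ∧
    (∀ y ∈ Y, {x | x ∈ X ∧ f x = y}.Finite) ∧
    GenericallyOn Y (fun y => {x | x ∈ X ∧ f x = y}.ncard = 2)

/-- Irreducible conics: irreducible plane sections of quadrics that are neither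
lines nor full planes. -/
def IsIrreducibleConic {m : ℕ} (C : Set (PS m)) : Prop :=
  ∃ (W : Submodule ℂ (Fin m → ℂ)) (q : MvPolynomial (Fin m) ℂ),
    Module.finrank ℂ W = 3 ∧ q.IsHomogeneous 2 ∧
    C = {x | x.submodule ≤ W ∧ PVanish q x} ∧
    ZIrreducible C ∧ ¬ IsLine C ∧ C ≠ {x | x.submodule ≤ W}

/-- "P holds for two general points of X." -/
def GenericallyOnPairs {m : ℕ} (X : Set (PS m)) (P : PS m → PS m → Prop) : Prop :=
  ∃ B : Set (PS m × PS m), ZClosedProd B ∧ ¬ X ×ˢ X ⊆ B ∧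
    ∀ x ∈ X, ∀ y ∈ X, (x, y) ∉ B → P x y

/-- `X` is conic-connected: through two general points of `X` there passes an
irreducible conic contained in `X`. -/
def ConicConnected {m : ℕ} (X : Set (PS m)) : Prop :=
  GenericallyOnPairs X fun x y =>
    ∃ C : Set (PS m), IsIrreducibleConic C ∧ C ⊆ X ∧ x ∈ C ∧ y ∈ C

/-- An interpretation of the transcendental / cohomological invariants of
embedded projective varieties used in the paper: being Fano, the Fano index,
`Pic ≅ ℤ`, degrees of normal bundles of lines, the degree, and conditions on
`H²`, `H⁴`, Chern classes and the second Chern character. -/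
structure GeomInterp where
  /-- `X` is a Fano variety. -/
  IsFanoVariety : ∀ {m : ℕ}, Set (PS m) → Prop
  /-- The Fano index of `X`: the maximal `r` such that `r` divides `-K_X` in `Pic X`. -/
  fanoIndex : ∀ {m : ℕ}, Set (PS m) → ℕ
  /-- `Pic X ≅ ℤ`. -/
  PicIsZ : ∀ {m : ℕ}, Set (PS m) → Prop
  /-- `deg N_{ℓ/X}`, the degree of the normal bundle of a line `ℓ ⊆ X`. -/
  normalBundleDeg : ∀ {m : ℕ}, Set (PS m) → Set (PS m) → ℤ
  /-- The degree of `X`, i.e. the self-intersection number `H^{dim X}`. -/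
  degreeOf : ∀ {m : ℕ}, Set (PS m) → ℕ
  /-- `H²(X, ℤ) ≅ ℤ[H]`, generated by the hyperplane class. -/
  H2GenByHyperplane : ∀ {m : ℕ}, Set (PS m) → Prop
  /-- `H⁴(X, ℤ) ≅ ℤ[H²]`. -/
  H4GenByHyperplaneSq : ∀ {m : ℕ}, Set (PS m) → Prop
  /-- `c₁(X) = a·H` in `H²(X, ℤ)`. -/
  c1Eq : ∀ {m : ℕ}, Set (PS m) → ℤ → Prop
  /-- `c₂(X) = a·H²` in `H⁴(X, ℤ)`. -/
  c2Eq : ∀ {m : ℕ}, Set (PS m) → ℤ → Prop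
  /-- `ch₂(X) = (c₁(X)² - 2c₂(X))/2 = a·H²` in `H⁴(X, ℤ)`. -/
  ch2Eq : ∀ {m : ℕ}, Set (PS m) → ℤ → Prop

end PaperQV

namespace PaperQV

lemma submodule_map {m n : ℕ} (f : (Fin m → ℂ) →ₗ[ℂ] (Fin n → ℂ)) (hf : Function.Injective f)
    (x : PS m) : (Projectivization.map f hf x).submodule = x.submodule.map f := by
  induction x using Projectivization.ind with
  | h v hv => simp [Projectivization.map_mk, Submodule.map_span]

lemma eq_of_submodule_le {m : ℕ} {x y : PS m} (h : x.submodule ≤ y.submodule) : x = y :=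
  Projectivization.submodule_injective
    (Submodule.eq_of_le_of_finrank_eq h (by simp [Projectivization.finrank_submodule]))

lemma mk_submodule_le_iff {m : ℕ} {v : Fin m → ℂ} (hv : v ≠ 0) (V : Submodule ℂ (Fin m → ℂ)) :
    (Projectivization.mk ℂ v hv).submodule ≤ V ↔ v ∈ V := by
  simp [Projectivization.submodule_mk]

lemma derivative_aeval_line {m : ℕ} (p : MvPolynomial (Fin m) ℂ) (x v : Fin m → ℂ) :
    (Polynomial.derivative (MvPolynomial.aeval
      (fun i => Polynomial.C (x i) + Polynomial.C (v i) * Polynomial.X) p)).eval 0 =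
      polyDiff p x v := by
  have hx (p : MvPolynomial (Fin m) ℂ) : (MvPolynomial.aeval
      (fun i => Polynomial.C (x i) + Polynomial.C (v i) * Polynomial.X) p).eval 0 =
      MvPolynomial.eval x p := by
    induction p using MvPolynomial.induction_on with
    | C a => simp
    | add p q hp hq => simp [hp, hq]
    | mul_X p i hp => simp [hp]
  induction p using MvPolynomial.induction_on with
  | C a => simp [polyDiff]
  | add p q hp hq => simp_all [polyDiff, add_mul, Finset.sum_add_distrib]
  | mul_X p i hp =>
    simp_all [polyDiff, add_mul, Finset.sum_add_distrib, MvPolynomial.pderiv_X, Pi.single_apply,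
      Finset.sum_mul, apply_ite, ite_mul]
    simp only [mul_left_comm, mul_comm, add_comm]

/-- A linear space contained in `X` is contained in the tangent space at each of its points. -/
lemma le_tangentSubmodule {m : ℕ} {X : Set (PS m)} {x : PS m} {V : Submodule ℂ (Fin m → ℂ)}
    (hx : x.submodule ≤ V) (hV : {y : PS m | y.submodule ≤ V} ⊆ X) :
    V ≤ tangentSubmodule X x := by
  intro w hw
  simp only [tangentSubmodule, Submodule.mem_iInf, LinearMap.mem_ker]
  intro p hp
  have hxV : x.rep ∈ V := by
    rw [← mk_submodule_le_iff x.rep_nonzero, Projectivization.mk_rep]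
    exact hx
  have hzero (s : Fin m → ℂ) (hs : s ∈ V) : MvPolynomial.eval s p = 0 := by
    by_cases h : s = 0
    · exact hp x (hV hx) s (h ▸ zero_mem _)
    · refine hp (Projectivization.mk ℂ s h) (hV ((mk_submodule_le_iff h V).2 hs)) s ?_
      rw [← mk_submodule_le_iff h]
  rw [← derivative_aeval_line]
  suffices h : MvPolynomial.aeval
      (fun i => Polynomial.C (x.rep i) + Polynomial.C (w i) * Polynomial.X) p = 0 by simp [h]
  refine Polynomial.funext fun t => ?_
  have h := hzero (x.rep + t • w) (V.add_mem hxV (V.smul_mem t hw))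
  rw [Polynomial.eval_zero]
  refine Eq.trans ?_ h
  rw [← Polynomial.coe_evalRingHom, MvPolynomial.aeval_def, MvPolynomial.hom_eval₂,
    MvPolynomial.eval, MvPolynomial.coe_eval₂Hom]
  congr 1
  · exact RingHom.ext fun c => Polynomial.eval_C
  · exact funext fun i => by simp [mul_comm (w i)]

lemma map_image_coneOver {m n : ℕ} (g : (Fin m → ℂ) →ₗ[ℂ] (Fin n → ℂ))
    (hg : Function.Injective g) (o : PS m) (Y : Set (PS m)) :
    Projectivization.map g hg '' ConeOver o Y =
      ConeOver (Projectivization.map g hg o) (Projectivization.map g hg '' Y) := by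
  ext z
  constructor
  · rintro ⟨z, rfl | ⟨y, hy, hz⟩, rfl⟩
    · exact Or.inl rfl
    · refine Or.inr ⟨_, ⟨y, hy, rfl⟩, ?_⟩
      simpa only [submodule_map, ← Submodule.map_sup] using Submodule.map_mono hz
  · rintro (rfl | ⟨_, ⟨y, hy, rfl⟩, hz⟩)
    · exact ⟨o, Or.inl rfl, rfl⟩
    · induction z using Projectivization.ind with
      | h v hv =>
        rw [submodule_map, submodule_map, ← Submodule.map_sup, mk_submodule_le_iff] at hz
        obtain ⟨a, ha, rfl⟩ := hz
        have ha0 : a ≠ 0 := by rintro rfl; exact hv (map_zero g)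
        exact ⟨Projectivization.mk ℂ a ha0, Or.inr ⟨y, hy, (mk_submodule_le_iff ha0 _).2 ha⟩,
          Projectivization.map_mk _ _ _ _⟩

lemma lineThrough_map_rep {m n : ℕ} (x : PS m) (j : (Fin n → ℂ) →ₗ[ℂ] (Fin m → ℂ))
    (hj : Function.Injective j) (u : PS n) :
    LineThrough x (j u.rep) =
      {y | y.submodule ≤ x.submodule ⊔ (Projectivization.map j hj u).submodule} := by
  rw [LineThrough, submodule_map, u.submodule_eq, Submodule.map_span, Set.image_singleton]

/-- If `j` identifies `ℂⁿ` with a complement of `x` in the tangent space of `X` at `x`, the locus of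
lines through `x` is the cone with vertex `x` over the tangent directions of these lines. -/
lemma locusOfLines_eq_coneOver {m n : ℕ} {X : Set (PS m)} {x : PS m}
    (hx : ∃ L : Set (PS m), IsLine L ∧ x ∈ L ∧ L ⊆ X)
    (j : (Fin n → ℂ) →ₗ[ℂ] (Fin m → ℂ)) (hj : Function.Injective j)
    (hinf : LinearMap.range j ⊓ x.submodule = ⊥)
    (hsup : LinearMap.range j ⊔ x.submodule = tangentSubmodule X x) :
    LocusOfLines X x = ConeOver x
      (Projectivization.map j hj '' {u : PS n | LineThrough x (j u.rep) ⊆ X}) := by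
  ext z
  constructor
  · rintro ⟨_, ⟨⟨V, -, rfl⟩, hxV, hVX⟩, hzV⟩
    refine or_iff_not_imp_left.2 fun hzx => ?_
    induction z using Projectivization.ind with
    | h w hw =>
      have hwV : w ∈ V := (mk_submodule_le_iff hw V).1 hzV
      have hwT := le_tangentSubmodule hxV hVX hwV
      rw [← hsup, Submodule.mem_sup] at hwT
      obtain ⟨_, ⟨a, rfl⟩, b, hb, rfl⟩ := hwT
      have ha : a ≠ 0 := by
        rintro rfl
        exact hzx (eq_of_submodule_le ((mk_submodule_le_iff hw _).2 (by simpa using hb)))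
      have hjV : j a ∈ V := by simpa using V.sub_mem hwV (hxV hb)
      refine ⟨_, ⟨Projectivization.mk ℂ a ha, ?_, rfl⟩, ?_⟩
      · rw [Set.mem_ofPred_eq, lineThrough_map_rep x j hj]
        refine fun y hy => hVX (show y.submodule ≤ V from le_trans hy (sup_le hxV ?_))
        rwa [Projectivization.map_mk, mk_submodule_le_iff]
      · rw [mk_submodule_le_iff, add_comm, Projectivization.map_mk, Projectivization.submodule_mk]
        exact Submodule.add_mem_sup hb (Submodule.mem_span_singleton_self _)
  · rintro (rfl | ⟨_, ⟨u, hu, rfl⟩, hz⟩)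
    · obtain ⟨L, hL, hxL, hLX⟩ := hx
      exact ⟨L, ⟨hL, hxL, hLX⟩, hxL⟩
    · rw [Set.mem_ofPred_eq, lineThrough_map_rep x j hj] at hu
      refine ⟨_, ⟨⟨_, ?_, rfl⟩, show x.submodule ≤ _ from le_sup_left, hu⟩, hz⟩
      have hbot : x.submodule ⊓ (Projectivization.map j hj u).submodule = ⊥ := by
        rw [eq_bot_iff, ← hinf, inf_comm]
        exact inf_le_inf_right _ (submodule_map j hj u ▸ LinearMap.map_le_range)
      have h := Submodule.finrank_sup_add_finrank_inf_eq x.submodule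
        (Projectivization.map j hj u).submodule
      rw [hbot, finrank_bot] at h
      simpa [Projectivization.finrank_submodule] using h

/-- The hyperplane embedding `a ↦ (0, a)`. -/
def consZero (n : ℕ) : (Fin n → ℂ) →ₗ[ℂ] (Fin (n + 1) → ℂ) where
  toFun a := Fin.cons 0 a
  map_add' a b := by ext i; refine Fin.cases ?_ (fun i => ?_) i <;> simp
  map_smul' c a := by ext i; refine Fin.cases ?_ (fun i => ?_) i <;> simp

lemma consZero_injective (n : ℕ) : Function.Injective (consZero n) :=
  Fin.cons_right_injective (α := fun _ => ℂ) 0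

/-- The linear map `(t, a) ↦ t • v + j a`. -/
def consMap {m n : ℕ} (v : Fin m → ℂ) (j : (Fin n → ℂ) →ₗ[ℂ] (Fin m → ℂ)) :
    (Fin (n + 1) → ℂ) →ₗ[ℂ] (Fin m → ℂ) :=
  (LinearMap.proj 0).smulRight v + j ∘ₗ LinearMap.funLeft ℂ ℂ Fin.succ

lemma consMap_cons {m n : ℕ} (v : Fin m → ℂ) (j : (Fin n → ℂ) →ₗ[ℂ] (Fin m → ℂ))
    (t : ℂ) (a : Fin n → ℂ) : consMap v j (Fin.cons t a) = t • v + j a := by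
  simp [consMap, LinearMap.funLeft, Function.comp_def]

lemma consMap_injective {m n : ℕ} {v : Fin m → ℂ} (hv : v ≠ 0)
    {j : (Fin n → ℂ) →ₗ[ℂ] (Fin m → ℂ)} (hj : Function.Injective j)
    (hinf : LinearMap.range j ⊓ Submodule.span ℂ {v} = ⊥) : Function.Injective (consMap v j) := by
  rw [injective_iff_map_eq_zero]
  intro b
  refine Fin.consCases (fun t a h => ?_) b
  rw [consMap_cons] at h
  have hja : j a ∈ LinearMap.range j ⊓ Submodule.span ℂ {v} := by
    refine ⟨⟨a, rfl⟩, Submodule.mem_span_singleton.2 ⟨-t, ?_⟩⟩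
    rw [neg_smul, ← eq_neg_of_add_eq_zero_right h]
  rw [hinf, Submodule.mem_bot] at hja
  have ha : a = 0 := hj (by simpa using hja)
  have ht : t = 0 := by simpa [hja, hv] using h
  subst ha ht
  exact (consZero n).map_zero

lemma range_consMap {m n : ℕ} (v : Fin m → ℂ) (j : (Fin n → ℂ) →ₗ[ℂ] (Fin m → ℂ)) :
    LinearMap.range (consMap v j) = LinearMap.range j ⊔ Submodule.span ℂ {v} := by
  ext w
  rw [sup_comm, Submodule.mem_sup]
  constructor
  · rintro ⟨b, rfl⟩
    refine Fin.consCases (fun t a => ?_) b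
    exact ⟨t • v, Submodule.smul_mem _ _ (Submodule.mem_span_singleton_self v), j a, ⟨a, rfl⟩,
      (consMap_cons v j t a).symm⟩
  · rintro ⟨_, hy, _, ⟨a, rfl⟩, rfl⟩
    obtain ⟨t, rfl⟩ := Submodule.mem_span_singleton.1 hy
    exact ⟨Fin.cons t a, consMap_cons v j t a⟩

end PaperQV

open PaperQV

/-- **Proposition 5.3.** For the hypothetical variety `X ⊆ ℙ¹⁷` of Theorem
1.2 (iv) and a general point `x`, the locus of lines through `x`, inside the
projective tangent space `𝕋ₓX ≅ ℙ¹¹`, is projectively equivalent to the cone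
`Cone(o', Lₓ) ⊆ ℙ¹¹` with vertex a point `o' ∈ ℙ¹¹ \ ℙ((TₓX)⋁)`. -/
theorem locus_of_lines_is_cone (𝒢 : GeomInterp) (X : Set (PS 18))
    (hsm : SmoothVariety X 11) (hnd : Nondegenerate X) (hq : IsQuadratic X)
    (hF : 𝒢.IsFanoVariety X) (hidx : 𝒢.fanoIndex X = 8)
    (hlines : CoveredByLines X)
    (hvmrt : GenericallyOn X (fun x => ∃ W : Set (PS 11), IsVMRTModel X x W ∧
      ∃ G : Set (PS 11), IsGushelMukai6 G ∧ ProjEquiv W G)) :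
    GenericallyOn X (fun x => ∃ W : Set (PS 11), IsVMRTModel X x W ∧
      ∃ (g : (Fin 12 → ℂ) →ₗ[ℂ] (Fin 18 → ℂ)) (hg : Function.Injective g)
        (j : (Fin 11 → ℂ) →ₗ[ℂ] (Fin 12 → ℂ)) (hj : Function.Injective j)
        (o : PS 12),
        ¬ o.submodule ≤ LinearMap.range j ∧
        LinearMap.range g = tangentSubmodule X x ∧
        Projectivization.map g hg ''
            (ConeOver o (Projectivization.map j hj '' W)) = LocusOfLines X x) := by
  obtain ⟨C, hC, hXC, h⟩ := hvmrt
  refine ⟨C, hC, hXC, fun x hx => ?_⟩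
  obtain ⟨W, hW, -⟩ := h x hx
  refine ⟨W, hW, ?_⟩
  obtain ⟨j, hj, hinf, hsup, rfl⟩ := hW
  have hg : Function.Injective (consMap x.rep j) :=
    consMap_injective x.rep_nonzero hj (by rwa [← x.submodule_eq])
  have ho : (Fin.cons 1 0 : Fin 12 → ℂ) ≠ 0 := fun h => one_ne_zero (congrFun h 0)
  refine ⟨consMap x.rep j, hg, consZero 11, consZero_injective 11,
    Projectivization.mk ℂ (Fin.cons 1 0) ho, ?_, ?_, ?_⟩
  · rw [mk_submodule_le_iff]
    rintro ⟨a, ha⟩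
    exact zero_ne_one (congrFun ha 0)
  · rw [range_consMap, ← x.submodule_eq, hsup]
  · rw [map_image_coneOver, locusOfLines_eq_coneOver (hlines x hx.1) j hj hinf hsup,
      Set.image_image]
    congr 1
    · simp [Projectivization.map_mk, consMap_cons, Projectivization.mk_rep]
    · refine Set.image_congr fun u _ => ?_
      induction u using Projectivization.ind with
      | h v hv => simp [Projectivization.map_mk, consZero, consMap_cons]
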